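/- Let W : ℝ^d → M_n(ℂ) be measurable, positive definite a.e., and 1 < p ≤ 2. Suppose that for each cube I there are positive definite matrices V_I with |I|^{−1/p}‖1_I W^{1/p} e‖_{L^p} ≈ |V_I e| for all e ∈ ℂ^n, and suppose the matrix A_p condition sup_I (1/|I|)∫_I ((1/|I|)∫_I ‖W^{1/p}(x) W^{−1/p}(t)‖^{p'} dt)^{p/p'} dx < ∞ holds. If A is a constant n×n matrix with sup_I ‖V_I A V_I^{−1}‖ < ∞ (supremum over all cubes I), then ‖W^{1/p}(u) A W^{−1/p}(u)‖ is essentially bounded, i.e., the multiplication operator f ↦ A f is bounded on L^p(W). -/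

import Mathlib

open MeasureTheory
open scoped ComplexOrder

/-- Operator norm of an `n × n` complex matrix on Euclidean `ℂⁿ`. -/
noncomputable def opN {n : ℕ} (A : Matrix (Fin n) (Fin n) ℂ) : ℝ :=
  ‖Matrix.toEuclideanCLM (𝕜 := ℂ) A‖

/-- Euclidean norm of a vector in `ℂⁿ`. -/
noncomputable def eN {n : ℕ} (v : Fin n → ℂ) : ℝ :=
  Real.sqrt (∑ i, ‖v i‖ ^ 2)

/-- The (half-open, axis-parallel) cube with corner `c` and side length `r`. -/
def cube {d : ℕ} (c : Fin d → ℝ) (r : ℝ) : Set (Fin d → ℝ) :=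
  {x | ∀ i, c i ≤ x i ∧ x i < c i + r}

/-- `eN` is the norm of `EuclideanSpace ℂ (Fin n)`. -/
lemma eN_eq_norm {n : ℕ} (v : Fin n → ℂ) : eN v = ‖WithLp.toLp 2 v‖ := by
  rw [eN, EuclideanSpace.norm_eq]

lemma eN_nonneg {n : ℕ} (v : Fin n → ℂ) : 0 ≤ eN v := Real.sqrt_nonneg _

lemma continuous_eN {n : ℕ} : Continuous (eN (n := n)) := by
  unfold eN
  fun_prop

lemma eN_mulVec_le {n : ℕ} (M : Matrix (Fin n) (Fin n) ℂ) (v : Fin n → ℂ) :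
    eN (M.mulVec v) ≤ opN M * eN v := by
  have h := (Matrix.toEuclideanCLM (𝕜 := ℂ) M).le_opNorm (WithLp.toLp 2 v)
  rw [Matrix.toEuclideanCLM_toLp] at h
  simpa only [eN_eq_norm, opN] using h

lemma opN_le_of_eN_mulVec_le {n : ℕ} (M : Matrix (Fin n) (Fin n) ℂ) {K : ℝ} (hK : 0 ≤ K)
    (h : ∀ v, eN (M.mulVec v) ≤ K * eN v) : opN M ≤ K := by
  refine ContinuousLinearMap.opNorm_le_bound _ hK fun x => ?_
  have hx := h x.ofLp
  rw [eN_eq_norm, eN_eq_norm, ← Matrix.toEuclideanCLM_toLp] at hx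
  simpa using hx

/-- For invertible `M`, the bound `|M A v| ≤ ‖M A M⁻¹‖ |M v|`. -/
lemma eN_mulVec_mulVec_le {n : ℕ} {M : Matrix (Fin n) (Fin n) ℂ} (hM : M.PosDef)
    (A : Matrix (Fin n) (Fin n) ℂ) (v : Fin n → ℂ) :
    eN (M.mulVec (A.mulVec v)) ≤ opN (M * A * M⁻¹) * eN (M.mulVec v) := by
  have hdet : IsUnit M.det := (Matrix.isUnit_iff_isUnit_det M).1 hM.isUnit
  have h := eN_mulVec_le (M * A * M⁻¹) (M.mulVec v)
  rwa [Matrix.mulVec_mulVec, mul_assoc, Matrix.nonsing_inv_mul M hdet, mul_one,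
    ← Matrix.mulVec_mulVec] at h

/-- Converse of `eN_mulVec_mulVec_le`. -/
lemma opN_conj_le {n : ℕ} {M : Matrix (Fin n) (Fin n) ℂ} (hM : M.PosDef)
    (A : Matrix (Fin n) (Fin n) ℂ) {K : ℝ} (hK : 0 ≤ K)
    (h : ∀ v, eN (M.mulVec (A.mulVec v)) ≤ K * eN (M.mulVec v)) : opN (M * A * M⁻¹) ≤ K := by
  have hdet : IsUnit M.det := (Matrix.isUnit_iff_isUnit_det M).1 hM.isUnit
  refine opN_le_of_eN_mulVec_le _ hK fun v => ?_
  have hv := h (M⁻¹.mulVec v)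
  rwa [Matrix.mulVec_mulVec v M M⁻¹, Matrix.mul_nonsing_inv M hdet, Matrix.one_mulVec,
    Matrix.mulVec_mulVec, Matrix.mulVec_mulVec] at hv

lemma cube_ae_eq_closedBall {d : ℕ} (x : Fin d → ℝ) {r : ℝ} (hr : 0 < r) :
    cube (fun i => x i - r) (2 * r) =ᵐ[volume] Metric.closedBall x r := by
  have h1 : cube (fun i => x i - r) (2 * r)
      = Set.univ.pi fun i => Set.Ico (x i - r) (x i + r) := by
    ext y
    simp only [cube, Set.mem_ofPred_eq, Set.mem_univ_pi, Set.mem_Ico]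
    refine forall_congr' fun i => ?_
    rw [show x i - r + 2 * r = x i + r by ring]
  have h2 : Metric.closedBall x r = Set.Icc (fun i => x i - r) (fun i => x i + r) := by
    rw [closedBall_pi x hr.le, ← Set.pi_univ_Icc]
    simp only [Real.closedBall_eq_Icc]
  rw [h1, h2]
  exact Measure.univ_pi_Ico_ae_eq_Icc

/-- If the integrals of `f` over cubes are finite and dominated by those of `g`, which are also
finite, then `f ≤ g` almost everywhere. -/
lemma ae_le_of_lintegral_cube_le {d : ℕ} {f g : (Fin d → ℝ) → ENNReal}
    (hf : Measurable f) (hg : Measurable g)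
    (hgfin : ∀ c r, 0 < r → ∫⁻ x in cube c r, g x ≠ ⊤)
    (hle : ∀ c r, 0 < r → ∫⁻ x in cube c r, f x ≤ ∫⁻ x in cube c r, g x) :
    ∀ᵐ x, f x ≤ g x := by
  have key : ∀ (k : (Fin d → ℝ) → ENNReal) (x : Fin d → ℝ) (r : ℝ), 0 < r →
      volume.withDensity k (Metric.closedBall x r)
        = ∫⁻ y in cube (fun i => x i - r) (2 * r), k y := fun k x r hr => by
    rw [withDensity_apply _ Metric.isClosed_closedBall.measurableSet]
    exact (setLIntegral_congr (cube_ae_eq_closedBall x hr)).symm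
  have loc : ∀ k : (Fin d → ℝ) → ENNReal, (∀ c r, 0 < r → ∫⁻ x in cube c r, k x ≠ ⊤) →
      IsLocallyFiniteMeasure (volume.withDensity k) := fun k hk => by
    refine ⟨fun x => ⟨Metric.closedBall x 1, Metric.closedBall_mem_nhds x one_pos, ?_⟩⟩
    rw [key k x 1 one_pos]
    exact (hk _ _ (by norm_num)).lt_top
  have := loc g hgfin
  have := loc f fun c r hr => ((hle c r hr).trans_lt (hgfin c r hr).lt_top).ne
  filter_upwards [Besicovitch.ae_tendsto_rnDeriv (volume.withDensity f) volume,
    Besicovitch.ae_tendsto_rnDeriv (volume.withDensity g) volume,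
    Measure.rnDeriv_withDensity volume hf, Measure.rnDeriv_withDensity volume hg]
    with x h1 h2 h3 h4
  rw [h3] at h1
  rw [h4] at h2
  refine le_of_tendsto_of_tendsto h1 h2 ?_
  filter_upwards [self_mem_nhdsWithin] with r hr
  have hr : 0 < r := hr
  rw [key f x r hr, key g x r hr]
  exact ENNReal.div_le_div_right (hle _ _ (by positivity)) _

lemma volume_cube {d : ℕ} (c : Fin d → ℝ) (r : ℝ) :
    volume (cube c r) = ENNReal.ofReal r ^ d := by
  have h : cube c r = Set.univ.pi fun i => Set.Ico (c i) (c i + r) := by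
    ext y
    simp [cube]
  rw [h, volume_pi_pi]
  simp

/-- Let `Wp` play the role of `W^{1/p}` for a matrix weight `W` on `ℝ^d`, positive definite a.e.,
`1 < p ≤ 2`.  Suppose that for each cube `I` there are positive definite reducing matrices `V_I`
with `|I|^{-1/p} ‖1_I W^{1/p} e‖_{L^p} ≈ |V_I e|` for all `e`, and that the matrix `A_p` condition
holds.  If `A` is a constant matrix with `sup_I ‖V_I A V_I⁻¹‖ < ∞`, then
`‖W^{1/p}(u) A W^{-1/p}(u)‖` is essentially bounded, i.e. `f ↦ A f` is bounded on `L^p(W)`. -/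
theorem stmt2 (n d : ℕ) (p : ℝ) (hp1 : 1 < p) (hp2 : p ≤ 2)
    (Wp : (Fin d → ℝ) → Matrix (Fin n) (Fin n) ℂ)
    (hWmeas : ∀ i j, Measurable fun x => Wp x i j)
    (hWpos : ∀ᵐ x : Fin d → ℝ, (Wp x).PosDef)
    (V : (Fin d → ℝ) → ℝ → Matrix (Fin n) (Fin n) ℂ)
    (hVpos : ∀ c r, 0 < r → (V c r).PosDef)
    (c₁ c₂ : ℝ) (hc₁ : 0 < c₁) (hc₂ : 0 < c₂)
    (hred : ∀ (c : Fin d → ℝ) (r : ℝ), 0 < r → ∀ e : Fin n → ℂ,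
      ENNReal.ofReal (c₁ * eN ((V c r).mulVec e)) ≤
        ((volume (cube c r))⁻¹ *
          ∫⁻ x in cube c r, ENNReal.ofReal (eN ((Wp x).mulVec e) ^ p)) ^ (1 / p) ∧
      ((volume (cube c r))⁻¹ *
          ∫⁻ x in cube c r, ENNReal.ofReal (eN ((Wp x).mulVec e) ^ p)) ^ (1 / p) ≤
        ENNReal.ofReal (c₂ * eN ((V c r).mulVec e)))
    (CAp : ℝ)
    (hAp : ∀ (c : Fin d → ℝ) (r : ℝ), 0 < r →
      (volume (cube c r))⁻¹ *
        ∫⁻ x in cube c r,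
          ((volume (cube c r))⁻¹ *
            ∫⁻ t in cube c r,
              ENNReal.ofReal (opN (Wp x * (Wp t)⁻¹) ^ (p / (p - 1)))) ^ (p / (p / (p - 1)))
        ≤ ENNReal.ofReal CAp)
    (A : Matrix (Fin n) (Fin n) ℂ) (CA : ℝ)
    (hA : ∀ (c : Fin d → ℝ) (r : ℝ), 0 < r → opN (V c r * A * (V c r)⁻¹) ≤ CA) :
    ∃ C : ℝ, ∀ᵐ u : Fin d → ℝ, opN (Wp u * A * (Wp u)⁻¹) ≤ C := by
  have hCA : 0 ≤ CA := (norm_nonneg _).trans (hA 0 1 one_pos)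
  have hp0 : 0 < p := by linarith
  set K : ℝ := c₂ * CA / c₁ with hKdef
  have hK : 0 ≤ K := by positivity
  have hvol0 : ∀ (c : Fin d → ℝ) (r : ℝ), 0 < r → volume (cube c r) ≠ 0 := fun c r hr => by
    rw [volume_cube]
    exact pow_ne_zero _ (ENNReal.ofReal_pos.2 hr).ne'
  have hvolt : ∀ (c : Fin d → ℝ) (r : ℝ), volume (cube c r) ≠ ⊤ := fun c r => by
    rw [volume_cube]
    exact ENNReal.pow_ne_top ENNReal.ofReal_ne_top
  have hmeas : ∀ e : Fin n → ℂ,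
      Measurable fun x => ENNReal.ofReal (eN ((Wp x).mulVec e) ^ p) := fun e => by
    have h : Measurable fun x => (Wp x).mulVec e := by
      refine measurable_pi_iff.2 fun i => ?_
      simp only [Matrix.mulVec, dotProduct]
      exact Finset.measurable_sum _ fun j _ => (hWmeas i j).mul_const _
    exact ((continuous_eN.measurable.comp h).pow_const p).ennreal_ofReal
  have hfin : ∀ (e : Fin n → ℂ) (c : Fin d → ℝ) (r : ℝ), 0 < r →
      ∫⁻ x in cube c r, ENNReal.ofReal (eN ((Wp x).mulVec e) ^ p) ≠ ⊤ := fun e c r hr htop => by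
    have h := (hred c r hr e).2
    rw [htop, ENNReal.mul_top (ENNReal.inv_ne_zero.2 (hvolt c r)),
      ENNReal.top_rpow_of_pos (by positivity)] at h
    exact ENNReal.ofReal_ne_top (top_le_iff.1 h)
  have hint : ∀ (e : Fin n → ℂ) (c : Fin d → ℝ) (r : ℝ), 0 < r →
      ∫⁻ x in cube c r, ENNReal.ofReal (eN ((Wp x).mulVec (A.mulVec e)) ^ p) ≤
        ENNReal.ofReal K ^ p *
          ∫⁻ x in cube c r, ENNReal.ofReal (eN ((Wp x).mulVec e) ^ p) := fun e c r hr => by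
    have hV : c₂ * eN ((V c r).mulVec (A.mulVec e)) ≤ K * (c₁ * eN ((V c r).mulVec e)) := by
      have h : eN ((V c r).mulVec (A.mulVec e)) ≤ CA * eN ((V c r).mulVec e) :=
        (eN_mulVec_mulVec_le (hVpos c r hr) A e).trans
          (mul_le_mul_of_nonneg_right (hA c r hr) (eN_nonneg _))
      calc c₂ * eN ((V c r).mulVec (A.mulVec e))
          ≤ c₂ * (CA * eN ((V c r).mulVec e)) := by gcongr
        _ = K * (c₁ * eN ((V c r).mulVec e)) := by rw [hKdef]; field_simp
    have h := ((hred c r hr (A.mulVec e)).2.trans (ENNReal.ofReal_le_ofReal hV))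
    rw [ENNReal.ofReal_mul hK] at h
    have h' := h.trans (mul_le_mul_right (hred c r hr e).1 (ENNReal.ofReal K))
    have h'' := ENNReal.rpow_le_rpow h' hp0.le
    rw [ENNReal.mul_rpow_of_nonneg _ _ hp0.le, ← ENNReal.rpow_mul, ← ENNReal.rpow_mul,
      one_div_mul_cancel hp0.ne', ENNReal.rpow_one, ENNReal.rpow_one, mul_left_comm] at h''
    exact (ENNReal.mul_le_mul_iff_right (ENNReal.inv_ne_zero.2 (hvolt c r))
      (ENNReal.inv_ne_top.2 (hvol0 c r hr))).1 h''
  have hae : ∀ e : Fin n → ℂ, ∀ᵐ u : Fin d → ℝ,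
      eN ((Wp u).mulVec (A.mulVec e)) ≤ K * eN ((Wp u).mulVec e) := fun e => by
    have hKt : ENNReal.ofReal K ^ p ≠ ⊤ := ENNReal.rpow_ne_top_of_nonneg hp0.le
      ENNReal.ofReal_ne_top
    have hbound := ae_le_of_lintegral_cube_le (hmeas (A.mulVec e))
      ((hmeas e).const_mul (ENNReal.ofReal K ^ p))
      (fun c r hr => by
        rw [lintegral_const_mul _ (hmeas e)]
        exact ENNReal.mul_ne_top hKt (hfin e c r hr))
      (fun c r hr => by
        rw [lintegral_const_mul _ (hmeas e)]
        exact hint e c r hr)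
    filter_upwards [hbound] with u hu
    have hnn := mul_nonneg hK (eN_nonneg ((Wp u).mulVec e))
    rw [ENNReal.ofReal_rpow_of_nonneg hK hp0.le, ← ENNReal.ofReal_mul (by positivity),
      ← Real.mul_rpow hK (eN_nonneg _), ENNReal.ofReal_le_ofReal_iff (by positivity)] at hu
    exact (Real.rpow_le_rpow_iff (eN_nonneg _) hnn hp0).1 hu
  refine ⟨K, ?_⟩
  have hall := ae_all_iff.2 fun k => hae (TopologicalSpace.denseSeq (Fin n → ℂ) k)
  filter_upwards [hall, hWpos] with u hu hpos
  refine opN_conj_le hpos A hK fun v => ?_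
  have hcl : IsClosed {e : Fin n → ℂ |
      eN ((Wp u).mulVec (A.mulVec e)) ≤ K * eN ((Wp u).mulVec e)} := by
    refine isClosed_le (continuous_eN.comp ?_) (continuous_const.mul (continuous_eN.comp ?_))
    · exact continuous_const.matrix_mulVec (continuous_const.matrix_mulVec continuous_id)
    · exact continuous_const.matrix_mulVec continuous_id
  exact (TopologicalSpace.denseRange_denseSeq (Fin n → ℂ)).induction_on v hcl hu
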